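/- Let p = ℘(·; g₂, g₃) be a Weierstrass elliptic function with fundamental half-periods ω, ω′, and let q = ℘(·; ω, ω′/3). If b = p(2ω′/3), then the invariants of q are h₂ = 120b² − 9g₂ and h₃ = 280b³ − 42b·g₂ − 27g₃. -/

import Mathlib

open Complex

/-- The Weierstrass ℘-function for the lattice generated by `2ω` and `2ω'`. -/
noncomputable def wp (ω ω' : ℂ) (z : ℂ) : ℂ :=
  1 / z ^ 2 + ∑' p : {p : ℤ × ℤ // p ≠ 0},
    (1 / (z - (2 * (p.1.1 : ℂ) * ω + 2 * (p.1.2 : ℂ) * ω')) ^ 2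
      - 1 / (2 * (p.1.1 : ℂ) * ω + 2 * (p.1.2 : ℂ) * ω') ^ 2)

/-- The quadrinvariant g₂ of the lattice generated by `2ω` and `2ω'`. -/
noncomputable def g2inv (ω ω' : ℂ) : ℂ :=
  60 * ∑' p : {p : ℤ × ℤ // p ≠ 0},
    1 / (2 * (p.1.1 : ℂ) * ω + 2 * (p.1.2 : ℂ) * ω') ^ 4

/-- The cubinvariant g₃ of the lattice generated by `2ω` and `2ω'`. -/
noncomputable def g3inv (ω ω' : ℂ) : ℂ :=
  140 * ∑' p : {p : ℤ × ℤ // p ≠ 0},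
    1 / (2 * (p.1.1 : ℂ) * ω + 2 * (p.1.2 : ℂ) * ω') ^ 6

namespace PeriodPair

variable (L : PeriodPair)

lemma isPreconnected_compl_lattice : IsPreconnected (L.lattice : Set ℂ)ᶜ := by
  have hc : (L.lattice : Set ℂ).Countable := by
    have : Countable L.lattice := L.latticeEquivProd.toEquiv.countable_iff.mpr inferInstance
    exact Set.to_countable _
  exact (hc.isConnected_compl_of_one_lt_rank (by simp)).isPreconnected

lemma not_forall_derivWeierstrassP_eq_zero :
    ¬ ∀ z ∈ (L.lattice : Set ℂ)ᶜ, L.derivWeierstrassP z = 0 := by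
  intro h
  have h₁ : (L.ω₁ / 2) ∈ (L.lattice : Set ℂ)ᶜ := L.ω₁_div_two_notMem_lattice
  have hconst : ∀ z ∈ (L.lattice : Set ℂ)ᶜ, L.weierstrassP z = L.weierstrassP (L.ω₁ / 2) :=
    fun z hz ↦ L.isClosed_lattice.isOpen_compl.is_const_of_deriv_eq_zero
      L.isPreconnected_compl_lattice L.differentiableOn_weierstrassP
      (fun w hw ↦ by simpa using h w hw) hz h₁
  have hev : L.weierstrassP =ᶠ[nhdsWithin 0 {0}ᶜ] fun _ ↦ L.weierstrassP (L.ω₁ / 2) := by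
    filter_upwards [self_mem_nhdsWithin,
      mem_nhdsWithin_of_mem_nhds (L.compl_lattice_sdiff_singleton_mem_nhds 0)] with z hz hz'
    exact hconst z fun hzL ↦ hz' ⟨hzL, hz⟩
  have hord := L.order_weierstrassP 0 (zero_mem _)
  rw [meromorphicOrderAt_congr hev] at hord
  have hnn := (analyticAt_const (𝕜 := ℂ) (v := L.weierstrassP (L.ω₁ / 2))
    (x := (0 : ℂ))).meromorphicOrderAt_nonneg
  rw [hord] at hnn
  exact absurd hnn (by decide)

lemma hasDerivAt_weierstrassP {z : ℂ} (hz : z ∉ L.lattice) :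
    HasDerivAt L.weierstrassP (L.derivWeierstrassP z) z := by
  rw [← L.deriv_weierstrassP]
  exact (L.analyticOnNhd_weierstrassP z hz).differentiableAt.hasDerivAt

lemma deriv_derivWeierstrassP {z : ℂ} (hz : z ∉ L.lattice) :
    deriv L.derivWeierstrassP z = 6 * L.weierstrassP z ^ 2 - L.g₂ / 2 := by
  have hP := L.analyticOnNhd_weierstrassP
  have hP' := L.analyticOnNhd_derivWeierstrassP
  have key := AnalyticOnNhd.eq_zero_or_eq_zero_of_mul_eq_zero hP'
    (g := fun w ↦ deriv L.derivWeierstrassP w - (6 * L.weierstrassP w ^ 2 - L.g₂ / 2))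
    (hP'.deriv.sub ((analyticOnNhd_const.mul (hP.pow 2)).sub analyticOnNhd_const))
    (fun w hw ↦ ?_) L.isPreconnected_compl_lattice
  · exact sub_eq_zero.mp (key.resolve_left L.not_forall_derivWeierstrassP_eq_zero z hz)
  · have heq : Set.EqOn (fun w ↦ L.derivWeierstrassP w ^ 2)
        (fun w ↦ 4 * L.weierstrassP w ^ 3 - L.g₂ * L.weierstrassP w - L.g₃)
        (L.lattice : Set ℂ)ᶜ := fun w hw ↦ L.derivWeierstrassP_sq w hw
    have hd := heq.deriv L.isClosed_lattice.isOpen_compl hw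
    have h₁ := ((hP' w hw).differentiableAt.hasDerivAt.pow 2).deriv
    have h := L.hasDerivAt_weierstrassP hw
    have h₂ := ((((h.pow 3).const_mul 4).sub (h.const_mul L.g₂)).sub_const L.g₃).deriv
    have hd' := h₁.symm.trans (hd.trans h₂)
    simp only [Nat.cast_ofNat] at hd'
    linear_combination hd' / 2

lemma iteratedDeriv_weierstrassP {z : ℂ} (hz : z ∉ L.lattice) {n : ℕ} (hn : n ≠ 0) :
    iteratedDeriv n L.weierstrassP z = (n + 1).factorial * L.sumInvPow z (n + 2) := by
  have h := L.iteratedDeriv_weierstrassPExcept_self z (n := n)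
  rwa [L.weierstrassPExcept_of_notMem z hz, if_neg hn] at h

lemma sumInvPow_four {z : ℂ} (hz : z ∉ L.lattice) :
    L.sumInvPow z 4 = L.weierstrassP z ^ 2 - L.g₂ / 12 := by
  have h := L.iteratedDeriv_weierstrassP hz two_ne_zero
  rw [iteratedDeriv_succ, iteratedDeriv_one, L.deriv_weierstrassP,
    L.deriv_derivWeierstrassP hz] at h
  norm_num [Nat.factorial] at h
  linear_combination -h / 6

lemma sumInvPow_six {z : ℂ} (hz : z ∉ L.lattice) :
    L.sumInvPow z 6 =
      L.weierstrassP z ^ 3 - 3 / 20 * L.g₂ * L.weierstrassP z - L.g₃ / 10 := by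
  have hU := L.isClosed_lattice.isOpen_compl
  have h := L.iteratedDeriv_weierstrassP hz four_ne_zero
  have e₂ : Set.EqOn (deriv L.derivWeierstrassP) (fun w ↦ 6 * L.weierstrassP w ^ 2 - L.g₂ / 2)
      (L.lattice : Set ℂ)ᶜ := fun w hw ↦ L.deriv_derivWeierstrassP hw
  have e₃ : Set.EqOn (deriv (deriv L.derivWeierstrassP))
      (fun w ↦ 12 * (L.weierstrassP w * L.derivWeierstrassP w)) (L.lattice : Set ℂ)ᶜ := by
    refine (e₂.deriv hU).trans fun w hw ↦ ?_
    have h₂ := (((L.hasDerivAt_weierstrassP hw).pow 2).const_mul 6).sub_const (L.g₂ / 2)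
    refine h₂.deriv.trans ?_
    push_cast
    ring
  have e₄ := (e₃.deriv hU hz).trans (((L.hasDerivAt_weierstrassP hz).mul
    (L.analyticOnNhd_derivWeierstrassP z hz).differentiableAt.hasDerivAt).const_mul 12).deriv
  rw [L.deriv_derivWeierstrassP hz] at e₄
  rw [iteratedDeriv_succ, iteratedDeriv_succ, iteratedDeriv_succ, iteratedDeriv_one,
    L.deriv_weierstrassP, e₄] at h
  norm_num [Nat.factorial] at h
  linear_combination -h / 120 + L.derivWeierstrassP_sq z hz / 10

lemma sumInvPow_neg (x : ℂ) {r : ℕ} (hr : Even r) : L.sumInvPow (-x) r = L.sumInvPow x r := by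
  simp only [sumInvPow]
  rw [← (Equiv.neg L.lattice).tsum_eq]
  refine tsum_congr fun l ↦ ?_
  simp only [Equiv.neg_apply, NegMemClass.coe_neg]
  rw [← hr.neg_pow]
  congr 2
  ring

lemma sumInvPow_add_coe (x : ℂ) (l : L.lattice) (r : ℕ) :
    L.sumInvPow (x + l) r = L.sumInvPow x r := by
  simp only [sumInvPow]
  rw [← (Equiv.addRight l).tsum_eq]
  simp

lemma sumInvPow_eq_tsum_prod (x : ℂ) (r : ℕ) :
    L.sumInvPow x r = ∑' p : ℤ × ℤ, ((p.1 * L.ω₁ + p.2 * L.ω₂ - x) ^ r)⁻¹ := by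
  rw [sumInvPow, ← L.latticeEquivProd.symm.toEquiv.tsum_eq]
  simp [latticeEquiv_symm_apply]

lemma summable_prod {r : ℕ} (hr : 2 < r) :
    Summable fun p : ℤ × ℤ ↦ ((p.1 * L.ω₁ + p.2 * L.ω₂) ^ r)⁻¹ := by
  have h := (L.hasSum_sumInvPow 0 hr).summable
  rw [← L.latticeEquivProd.symm.toEquiv.summable_iff] at h
  simpa [Function.comp_def, latticeEquiv_symm_apply] using h

lemma third_notMem_lattice : L.ω₂ / 3 ∉ L.lattice := by
  simpa [inv_mul_eq_div] using
    (L.mul_ω₁_add_mul_ω₂_mem_lattice (α := 0) (β := 1 / 3)).not.mpr (by norm_num)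

/-- Split a double series according to the second index modulo three. -/
lemma tsum_prod_eq_sum_mod_three {f : ℤ × ℤ → ℂ} (hf : Summable f) :
    ∑' p, f p = ∑ i : Fin 3, ∑' p : ℤ × ℤ, f (p.1, p.2 * 3 + ((i : ℕ) : ℤ)) := by
  let e : Fin 3 × (ℤ × ℤ) ≃ ℤ × ℤ :=
    (Equiv.prodComm _ _).trans ((Equiv.prodAssoc _ _ _).trans
      ((Equiv.refl ℤ).prodCongr (Int.divModEquiv 3).symm))
  have hs : Summable (f ∘ e) := e.summable_iff.mpr hf
  rw [← tsum_fintype (L := .unconditional _), ← e.tsum_eq f]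
  exact hs.tsum_prod

/-- The Eisenstein series after dividing the second period by three. -/
lemma G_of_third {L M : PeriodPair} (h₁ : M.ω₁ = L.ω₁) (h₂ : M.ω₂ = L.ω₂ / 3) {r : ℕ}
    (hr : 2 < r) (hr' : Even r) :
    M.G r = L.G r + 2 * L.sumInvPow (L.ω₂ / 3) r := by
  have hterm : ∀ i : Fin 3,
      ∑' p : ℤ × ℤ, ((p.1 * M.ω₁ + ((p.2 * 3 + ((i : ℕ) : ℤ) : ℤ) : ℂ) * M.ω₂) ^ r)⁻¹ =
        L.sumInvPow (-((i : ℕ) * (L.ω₂ / 3))) r := by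
    intro i
    rw [sumInvPow_eq_tsum_prod]
    refine tsum_congr fun p ↦ ?_
    rw [h₁, h₂]
    push_cast
    congr 2
    ring
  have hneg := L.sumInvPow_neg (L.ω₂ / 3) hr'
  have htwo : L.sumInvPow (-(2 * (L.ω₂ / 3))) r = L.sumInvPow (L.ω₂ / 3) r := by
    rw [← L.sumInvPow_add_coe _ ⟨L.ω₂, L.ω₂_mem_lattice⟩]
    congr 1
    ring
  have hzero : L.sumInvPow 0 r = L.G r := by rw [sumInvPow_zero]
  rw [← sumInvPow_zero, sumInvPow_eq_tsum_prod]
  simp only [sub_zero]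
  rw [tsum_prod_eq_sum_mod_three (M.summable_prod hr)]
  simp only [hterm]
  rw [Fin.sum_univ_three]
  simp only [Fin.val_zero, Fin.val_one, Fin.val_two, Nat.cast_zero, Nat.cast_one, Nat.cast_ofNat,
    zero_mul, one_mul, neg_zero, hneg, htwo, hzero]
  ring

/-- The period pair `(2ω, 2ω')` of a pair of half-periods. -/
noncomputable def ofHalfPeriods (ω ω' : ℂ) (hω : ω ≠ 0) (hτ : (ω' / ω).im ≠ 0) : PeriodPair where
  ω₁ := 2 * ω
  ω₂ := 2 * ω'
  indep := by
    rw [LinearIndependent.pair_iff]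
    intro s t h
    have h' : (s : ℂ) + t * (ω' / ω) = 0 := by
      simp only [Complex.real_smul] at h
      field_simp
      linear_combination h / 2
    have ht : t = 0 := by
      have := congrArg Complex.im h'
      simpa [hτ] using this
    subst ht
    simpa using h'

end PeriodPair

lemma tsum_ne_zero_eq {α : Type*} [Zero α] (f : α → ℂ) (hf : f 0 = 0) :
    ∑' p : {p : α // p ≠ 0}, f p.1 = ∑' p, f p :=
  tsum_subtype_eq_of_support_subset (s := {p | p ≠ 0}) fun _ hp h ↦ hp (h ▸ hf)

section HalfPeriods

variable (ω ω' : ℂ) (hω : ω ≠ 0) (hτ : (ω' / ω).im ≠ 0)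

lemma tsum_inv_pow_eq_G {r : ℕ} (hr : r ≠ 0) :
    ∑' p : {p : ℤ × ℤ // p ≠ 0}, 1 / (2 * (p.1.1 : ℂ) * ω + 2 * (p.1.2 : ℂ) * ω') ^ r =
      (PeriodPair.ofHalfPeriods ω ω' hω hτ).G r := by
  rw [← PeriodPair.sumInvPow_zero, PeriodPair.sumInvPow_eq_tsum_prod,
    tsum_ne_zero_eq (fun p : ℤ × ℤ ↦ 1 / (2 * (p.1 : ℂ) * ω + 2 * (p.2 : ℂ) * ω') ^ r)
      (by simp [hr])]
  refine tsum_congr fun p ↦ ?_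
  simp only [PeriodPair.ofHalfPeriods, one_div, sub_zero]
  congr 2
  ring

lemma g2inv_eq : g2inv ω ω' = (PeriodPair.ofHalfPeriods ω ω' hω hτ).g₂ := by
  rw [g2inv, tsum_inv_pow_eq_G ω ω' hω hτ four_ne_zero, PeriodPair.g₂]

lemma g3inv_eq : g3inv ω ω' = (PeriodPair.ofHalfPeriods ω ω' hω hτ).g₃ := by
  rw [g3inv, tsum_inv_pow_eq_G ω ω' hω hτ (by norm_num), PeriodPair.g₃]

lemma wp_eq (z : ℂ) : wp ω ω' z = (PeriodPair.ofHalfPeriods ω ω' hω hτ).weierstrassP z := by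
  set L := PeriodPair.ofHalfPeriods ω ω' hω hτ with hL
  let f : ℤ × ℤ → ℂ := fun p ↦ 1 / (z - (2 * (p.1 : ℂ) * ω + 2 * (p.2 : ℂ) * ω')) ^ 2
      - 1 / (2 * (p.1 : ℂ) * ω + 2 * (p.2 : ℂ) * ω') ^ 2
  have hf : HasSum f (L.weierstrassP z) := by
    have h := L.hasSum_weierstrassP z
    rw [← L.latticeEquivProd.symm.toEquiv.hasSum_iff] at h
    refine (funext fun p ↦ ?_ : f = _) ▸ h
    have hp : (L.latticeEquivProd.symm p : ℂ) = 2 * p.1 * ω + 2 * p.2 * ω' := by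
      rw [PeriodPair.latticeEquiv_symm_apply]
      simp only [hL, PeriodPair.ofHalfPeriods]
      ring
    simp [f, hp]
  rw [← hf.tsum_eq, hf.summable.tsum_eq_add_tsum_ite 0,
    ← tsum_ne_zero_eq (fun p ↦ if p = 0 then 0 else f p) (if_pos rfl), wp]
  congr 1
  · simp [f]
  · exact tsum_congr fun p ↦ (if_neg p.2).symm

end HalfPeriods

/-- Cubic modular transformation: dividing the period 2ω′ by three sends the invariants
(g₂, g₃) to (120b² − 9g₂, 280b³ − 42b·g₂ − 27g₃) where b = ℘(2ω′/3). -/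
theorem stmt5 (ω ω' : ℂ) (hω : ω ≠ 0) (hτ : (ω' / ω).im ≠ 0)
    (g₂ g₃ b : ℂ) (hg₂ : g₂ = g2inv ω ω') (hg₃ : g₃ = g3inv ω ω')
    (hb : b = wp ω ω' (2 * ω' / 3)) :
    g2inv ω (ω' / 3) = 120 * b ^ 2 - 9 * g₂ ∧
    g3inv ω (ω' / 3) = 280 * b ^ 3 - 42 * b * g₂ - 27 * g₃ := by
  have hτ' : (ω' / 3 / ω).im ≠ 0 := by
    rw [show ω' / 3 / ω = ω' / ω / (3 : ℝ) by push_cast; ring, Complex.div_ofReal_im]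
    exact div_ne_zero hτ three_ne_zero
  rw [wp_eq ω ω' hω hτ] at hb
  rw [g2inv_eq ω ω' hω hτ] at hg₂
  rw [g3inv_eq ω ω' hω hτ] at hg₃
  rw [g2inv_eq ω (ω' / 3) hω hτ', g3inv_eq ω (ω' / 3) hω hτ']
  set L := PeriodPair.ofHalfPeriods ω ω' hω hτ
  set M := PeriodPair.ofHalfPeriods ω (ω' / 3) hω hτ'
  have h₁ : M.ω₁ = L.ω₁ := rfl
  have h₂ : M.ω₂ = L.ω₂ / 3 := (mul_div_assoc 2 ω' 3).symm
  change b = L.weierstrassP (L.ω₂ / 3) at hb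
  have h4 := PeriodPair.G_of_third h₁ h₂ (r := 4) (by norm_num) (by decide)
  have h6 := PeriodPair.G_of_third h₁ h₂ (r := 6) (by norm_num) (by decide)
  rw [L.sumInvPow_four L.third_notMem_lattice, ← hb, ← hg₂] at h4
  rw [L.sumInvPow_six L.third_notMem_lattice, ← hb, ← hg₂, ← hg₃] at h6
  have hL₂ : g₂ = 60 * L.G 4 := hg₂
  have hL₃ : g₃ = 140 * L.G 6 := hg₃
  rw [PeriodPair.g₂, PeriodPair.g₃]
  constructor
  · linear_combination 60 * h4 - hL₂
  · linear_combination 140 * h6 - hL₃
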